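/- Let d ≥ 2 (failure of Ornstein's non-inequality / of the L¹ Korn inequality): for every N > 0 there exists a Lipschitz map u : ℝ^d → ℝ^d vanishing outside the open unit ball B₁ with ∫_{B₁} |Du(x)| dx > 0 and such that inf_{F ∈ ℝ^{d×d}} ∫_{B₁} |Du(x) − F| dx ≥ N ∫_{B₁} |(Du(x) + Du(x)ᵀ)/2| dx, where Du denotes the (almost everywhere defined) Jacobian of u and |·| the Frobenius norm on matrices. -/

import Mathlib

open MeasureTheory

/-- The Jacobian matrix `(Du)_{ij} = ∂_j u_i` of a map on Euclidean space (defined via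
`fderiv`, which is `0` at points of non-differentiability; by Rademacher's theorem it is
the genuine Jacobian a.e. for Lipschitz maps). -/
noncomputable def jacob {d : ℕ} (u : EuclideanSpace ℝ (Fin d) → EuclideanSpace ℝ (Fin d))
    (x : EuclideanSpace ℝ (Fin d)) : Matrix (Fin d) (Fin d) ℝ :=
  fun i j => fderiv ℝ u x (EuclideanSpace.single j 1) i

/-- The Frobenius norm of a real matrix. -/
noncomputable def frob {d : ℕ} (M : Matrix (Fin d) (Fin d) ℝ) : ℝ :=
  Real.sqrt (∑ i, ∑ j, (M i j) ^ 2)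

open Filter Topology

/-- **Riemann-Lebesgue lemma** for oscillations along a coordinate axis. -/
theorem tendsto_integral_mul_cos {d : ℕ} (q : Fin d) {f : EuclideanSpace ℝ (Fin d) → ℂ}
    (hf : Integrable f) :
    Tendsto (fun K : ℝ => ∫ x, f x * (Real.cos (K * x q) : ℂ)) atTop (𝓝 0) := by
  have key : ∀ c : ℝ, c ≠ 0 → Tendsto (fun K : ℝ => ∫ x : EuclideanSpace ℝ (Fin d),
      Complex.exp ((c * K * x q : ℝ) * Complex.I) * f x) atTop (𝓝 0) := by
    intro c hc
    have h := tendsto_integral_exp_inner_smul_cocompact f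
    have hw : Tendsto (fun K : ℝ => (-(c * K) / (2 * Real.pi)) • EuclideanSpace.single q (1 : ℝ))
        atTop (cocompact (EuclideanSpace ℝ (Fin d))) := by
      rw [← Metric.cobounded_eq_cocompact, ← comap_norm_atTop, tendsto_comap_iff]
      have : (norm ∘ fun K : ℝ => (-(c * K) / (2 * Real.pi)) • EuclideanSpace.single q (1 : ℝ))
          = fun K => (|c| / (2 * Real.pi)) * |K| := by
        funext K
        simp [norm_smul, abs_of_pos Real.pi_pos]
        ring
      rw [this]
      exact (tendsto_abs_atTop_atTop).const_mul_atTop (by positivity)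
    refine (h.comp hw).congr fun K => ?_
    refine integral_congr_ae (ae_of_all _ fun x => ?_)
    simp only [Circle.smul_def, smul_eq_mul, Real.fourierChar_apply, inner_smul_right,
      EuclideanSpace.inner_single_right]
    congr 2
    simp
    field_simp
  have h1 := key 1 one_ne_zero
  have h2 := key (-1) (by norm_num)
  have h3 := (h1.add h2).div_const 2
  simp only [add_zero, zero_div] at h3
  refine h3.congr fun K => ?_
  have hi : ∀ c : ℝ, Integrable (fun x : EuclideanSpace ℝ (Fin d) =>
      Complex.exp ((c * K * x q : ℝ) * Complex.I) * f x) := by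
    intro c
    refine hf.bdd_mul (c := 1) (by fun_prop) (ae_of_all _ fun x => ?_)
    rw [Complex.norm_exp_ofReal_mul_I]
  rw [← integral_add (hi _) (hi _), ← integral_div]
  refine integral_congr_ae (ae_of_all _ fun x => ?_)
  simp only [Complex.ofReal_cos, Complex.cos]
  push_cast
  ring_nf

theorem tendsto_integral_quadratic_cos {d : ℕ} (q : Fin d)
    {f g h : EuclideanSpace ℝ (Fin d) → ℂ} (hf : Integrable f) (hg : Integrable g)
    (hh : Integrable h) :
    Tendsto (fun K : ℝ => ∫ x, (f x + g x * (Real.cos (K * x q) : ℂ)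
      + h x * (Real.cos (K * x q) : ℂ) ^ 2)) atTop (𝓝 ((∫ x, f x) + (∫ x, h x) / 2)) := by
  have hc : ∀ {k : EuclideanSpace ℝ (Fin d) → ℂ} (K : ℝ), Integrable k →
      Integrable fun x => k x * (Real.cos (K * x q) : ℂ) := by
    intro k K hk
    refine hk.mul_bdd (c := 1) (by fun_prop) (ae_of_all _ fun x => ?_)
    rw [Complex.norm_real]
    exact Real.abs_cos_le_one _
  have h2 := (tendsto_integral_mul_cos q hh).comp (tendsto_id.const_mul_atTop (zero_lt_two' ℝ))
  have h3 := ((tendsto_const_nhds (x := (∫ x, f x) + (∫ x, h x) / 2)).add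
    (tendsto_integral_mul_cos q hg)).add (h2.div_const 2)
  simp only [add_zero, zero_div] at h3
  refine h3.congr fun K => ?_
  simp only [Function.comp_apply, id]
  rw [← integral_div, ← integral_div, ← integral_add hf (hh.div_const 2),
    ← integral_add (f := fun x => f x + h x / 2) (hf.add (hh.div_const 2)) (hc K hg),
    ← integral_add (f := fun x => f x + h x / 2 + g x * (Real.cos (K * x q) : ℂ))
      ((hf.add (hh.div_const 2)).add (hc K hg)) ((hc (2 * K) hh).div_const 2)]
  refine integral_congr_ae (ae_of_all _ fun x => ?_)
  beta_reduce
  rw [mul_assoc, Real.cos_two_mul]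
  push_cast
  ring

theorem jacob_add_smul_single {d : ℕ} {p q : Fin d}
    {u : EuclideanSpace ℝ (Fin d) → EuclideanSpace ℝ (Fin d)} {P : EuclideanSpace ℝ (Fin d) → ℝ}
    (hu : Differentiable ℝ u) (hP : Differentiable ℝ P) {K : ℝ} (hK : K ≠ 0)
    (x : EuclideanSpace ℝ (Fin d)) (i j : Fin d) :
    jacob (fun y => u y + (K⁻¹ * P y * Real.sin (K * y q)) • EuclideanSpace.single p (1 : ℝ)) x i j
      = jacob u x i j + (if i = p then 1 else 0) *
        ((if j = q then 1 else 0) * (P x * Real.cos (K * x q))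
          + K⁻¹ * Real.sin (K * x q) * fderiv ℝ P x (EuclideanSpace.single j 1)) := by
  have hq : HasFDerivAt (fun y : EuclideanSpace ℝ (Fin d) => K * y q)
      (K • (EuclideanSpace.proj q : EuclideanSpace ℝ (Fin d) →L[ℝ] ℝ)) x :=
    (EuclideanSpace.proj q : EuclideanSpace ℝ (Fin d) →L[ℝ] ℝ).hasFDerivAt.const_mul K
  have h := (hu x).hasFDerivAt.add
    ((((hP x).hasFDerivAt.const_mul K⁻¹).mul hq.sin).smul_const (EuclideanSpace.single p (1 : ℝ)))
  simp only [jacob]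
  erw [h.fderiv]
  simp [eq_comm (a := q) (b := j)]
  by_cases hi : i = p <;> by_cases hj : j = q <;> simp [hi, hj] <;> field_simp

/-- A stage of the construction. The field `u` has Jacobian within less than `ε` of a matrix
supported on the entries `(p, q)` and `(q, p)`, the entries having sum `P - φ` and difference `Z`;
the function `R`, bounded by `M`, is to be integrated against `Z`. -/
structure IsOscillation {d : ℕ} (p q : Fin d) (φ : EuclideanSpace ℝ (Fin d) → ℝ) (ε M : ℝ)
    (u : EuclideanSpace ℝ (Fin d) → EuclideanSpace ℝ (Fin d))
    (P Z : EuclideanSpace ℝ (Fin d) → ℝ) (R : EuclideanSpace ℝ (Fin d) → ℂ) : Prop where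
  contDiff_field : ContDiff ℝ 1 u
  contDiff_sum : ContDiff ℝ 1 P
  continuous_diff : Continuous Z
  continuous_test : Continuous R
  field_eq_zero : ∀ x, x ∉ Metric.closedBall 0 (1 / 2) → u x = 0
  sum_eq_zero : ∀ x, x ∉ Metric.closedBall 0 (1 / 2) → P x = 0
  diff_eq_zero : ∀ x, x ∉ Metric.closedBall 0 (1 / 2) → Z x = 0
  sum_nonneg : ∀ x, 0 ≤ P x
  norm_test_le : ∀ x, ‖R x‖ ≤ M
  jacob_close : ∃ δ < ε, ∀ x i j, |jacob u x i j
    - ((if i = p ∧ j = q then (P x - φ x + Z x) / 2 else 0)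
      + (if i = q ∧ j = p then (P x - φ x - Z x) / 2 else 0))| ≤ δ

/-- The integrals of `P`, `P R` and `Z R` over all stages with the given parameters. -/
def oscillationIntegrals {d : ℕ} (p q : Fin d) (φ : EuclideanSpace ℝ (Fin d) → ℝ) (ε M : ℝ) :
    Set (ℂ × ℂ × ℂ) :=
  {v | ∃ u P Z R, IsOscillation p q φ ε M u P Z R ∧
    v = (∫ x, (P x : ℂ), ∫ x, (P x : ℂ) * R x, ∫ x, (Z x : ℂ) * R x)}

namespace IsOscillation

variable {d : ℕ} {p q : Fin d} {φ : EuclideanSpace ℝ (Fin d) → ℝ} {ε M : ℝ}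
  {u : EuclideanSpace ℝ (Fin d) → EuclideanSpace ℝ (Fin d)}
  {P Z : EuclideanSpace ℝ (Fin d) → ℝ} {R : EuclideanSpace ℝ (Fin d) → ℂ}

theorem swap (h : IsOscillation p q φ ε M u P Z R) :
    IsOscillation q p φ ε M u P (fun x => -Z x) R where
  contDiff_field := h.contDiff_field
  contDiff_sum := h.contDiff_sum
  continuous_diff := h.continuous_diff.neg
  continuous_test := h.continuous_test
  field_eq_zero := h.field_eq_zero
  sum_eq_zero := h.sum_eq_zero
  diff_eq_zero x hx := by simp [h.diff_eq_zero x hx]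
  sum_nonneg := h.sum_nonneg
  norm_test_le := h.norm_test_le
  jacob_close := by
    obtain ⟨δ, hδ, hj⟩ := h.jacob_close
    refine ⟨δ, hδ, fun x i j => ?_⟩
    rw [add_comm]
    simpa only [sub_neg_eq_add, ← sub_eq_add_neg] using hj x i j

theorem hasCompactSupport_sum (h : IsOscillation p q φ ε M u P Z R) : HasCompactSupport P :=
  HasCompactSupport.intro (isCompact_closedBall 0 (1 / 2)) h.sum_eq_zero

theorem hasCompactSupport_diff (h : IsOscillation p q φ ε M u P Z R) : HasCompactSupport Z :=
  HasCompactSupport.intro (isCompact_closedBall 0 (1 / 2)) h.diff_eq_zero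

theorem exists_step (h : IsOscillation p q φ ε M u P Z R) (a : ℝ) :
    ∀ᶠ K : ℝ in atTop, ∃ u', IsOscillation p q φ ε (M * √(1 + a ^ 2)) u'
      (fun x => P x * (1 + Real.cos (K * x q))) (fun x => Z x + P x * Real.cos (K * x q))
      (fun x => R x * (1 + Complex.I * a * (Real.cos (K * x q) : ℂ))) := by
  obtain ⟨δ, hδ, hj⟩ := h.jacob_close
  obtain ⟨C, hC⟩ := h.hasCompactSupport_sum.fderiv (𝕜 := ℝ) |>.exists_bound_of_continuous
    (h.contDiff_sum.continuous_fderiv one_ne_zero)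
  have hlim : Tendsto (fun K : ℝ => δ + K⁻¹ * C) atTop (𝓝 δ) := by
    simpa using (tendsto_inv_atTop_zero.mul_const C).const_add δ
  filter_upwards [hlim.eventually (gt_mem_nhds hδ), eventually_gt_atTop 0] with K hK hK0
  have hcont := h.contDiff_sum.continuous
  have hcZ := h.continuous_diff
  have hcR := h.continuous_test
  refine ⟨fun y => u y + (K⁻¹ * P y * Real.sin (K * y q)) • EuclideanSpace.single p (1 : ℝ),
    ?_, ?_, by fun_prop, by fun_prop, fun x hx => ?_, fun x hx => ?_, fun x hx => ?_,
    fun x => ?_, fun x => ?_, ⟨_, hK, fun x i j => ?_⟩⟩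
  · have h1 := h.contDiff_field
    have h2 := h.contDiff_sum
    have h3 : ContDiff ℝ 1 fun y : EuclideanSpace ℝ (Fin d) => y q := by fun_prop
    fun_prop
  · have h2 := h.contDiff_sum
    have h3 : ContDiff ℝ 1 fun y : EuclideanSpace ℝ (Fin d) => y q := by fun_prop
    fun_prop
  · simp [h.field_eq_zero x hx, h.sum_eq_zero x hx]
  · simp [h.sum_eq_zero x hx]
  · simp [h.diff_eq_zero x hx, h.sum_eq_zero x hx]
  · exact mul_nonneg (h.sum_nonneg x) (by linarith [Real.neg_one_le_cos (K * x q)])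
  · rw [norm_mul]
    refine mul_le_mul (h.norm_test_le x) ?_ (norm_nonneg _) ((norm_nonneg _).trans (h.norm_test_le x))
    have : (1 + Complex.I * a * (Real.cos (K * x q) : ℂ))
        = ((1 : ℝ) : ℂ) + ((a * Real.cos (K * x q) : ℝ) : ℂ) * Complex.I := by push_cast; ring
    rw [this, Complex.norm_add_mul_I]
    refine Real.sqrt_le_sqrt ?_
    nlinarith [Real.cos_sq_le_one (K * x q), sq_nonneg a]
  · rw [jacob_add_smul_single (h.contDiff_field.differentiable one_ne_zero)
      (h.contDiff_sum.differentiable one_ne_zero) hK0.ne']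
    have hb : |K⁻¹ * Real.sin (K * x q) * fderiv ℝ P x (EuclideanSpace.single j 1)| ≤ K⁻¹ * C := by
      rw [abs_mul, abs_mul, abs_of_pos (inv_pos.2 hK0), mul_assoc]
      refine mul_le_mul_of_nonneg_left ?_ (inv_pos.2 hK0).le
      have h1 := (fderiv ℝ P x).le_opNorm (EuclideanSpace.single j 1)
      rw [PiLp.norm_single, norm_one, mul_one, Real.norm_eq_abs] at h1
      calc _ ≤ 1 * |fderiv ℝ P x (EuclideanSpace.single j 1)| :=
            mul_le_mul_of_nonneg_right (Real.abs_sin_le_one _) (abs_nonneg _)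
        _ ≤ C := by rw [one_mul]; exact h1.trans (hC x)
    have hb0 := (abs_nonneg _).trans hb
    have hjx := hj x i j
    rw [abs_le] at hb hjx ⊢
    by_cases hi : i = p <;> by_cases hjq : j = q <;>
      simp only [hi, hjq, and_self, and_true, and_false, if_true, if_false]
        at hjx hb ⊢ <;> constructor <;> split_ifs at hjx ⊢ <;> linarith

theorem integrals_mem_closure (h : IsOscillation p q φ ε M u P Z R) (a : ℝ) :
    (∫ x, (P x : ℂ), (1 + Complex.I * a / 2) * ∫ x, (P x : ℂ) * R x,
      (∫ x, (Z x : ℂ) * R x) + Complex.I * a / 2 * ∫ x, (P x : ℂ) * R x) ∈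
      closure (oscillationIntegrals p q φ ε (M * √(1 + a ^ 2))) := by
  have hcP := h.contDiff_sum.continuous
  have hcZ := h.continuous_diff
  have hcR := h.continuous_test
  have hP : Integrable fun x => (P x : ℂ) :=
    (Continuous.integrable_of_hasCompactSupport hcP h.hasCompactSupport_sum).ofReal
  have hPR : Integrable fun x => (P x : ℂ) * R x :=
    hP.mul_bdd (c := M) hcR.aestronglyMeasurable (ae_of_all _ h.norm_test_le)
  have hZR : Integrable fun x => (Z x : ℂ) * R x :=
    (Continuous.integrable_of_hasCompactSupport hcZ h.hasCompactSupport_diff).ofReal.mul_bdd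
      (c := M) hcR.aestronglyMeasurable (ae_of_all _ h.norm_test_le)
  have t1 := tendsto_integral_quadratic_cos q hP hP (hP.const_mul 0)
  have t2 := tendsto_integral_quadratic_cos q hPR (hPR.const_mul (1 + Complex.I * a))
    (hPR.const_mul (Complex.I * a))
  have t3 := tendsto_integral_quadratic_cos q hZR ((hZR.const_mul (Complex.I * a)).add hPR)
    (hPR.const_mul (Complex.I * a))
  have t := t1.prodMk_nhds (t2.prodMk_nhds t3)
  simp only [integral_const_mul, zero_mul, integral_zero, zero_div, add_zero] at t
  have hlim : _ ∈ closure (oscillationIntegrals p q φ ε (M * √(1 + a ^ 2))) :=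
    mem_closure_of_tendsto t ?_
  · convert hlim using 3 <;> ring
  filter_upwards [h.exists_step a] with K ⟨u', hu'⟩
  refine ⟨u', _, _, _, hu', ?_⟩
  congr 1
  · congr 1
    funext x
    push_cast
    ring
  · congr 1 <;>
    · congr 1
      funext x
      push_cast [Pi.add_apply]
      ring

end IsOscillation

theorem mem_closure_oscillationIntegrals_step {d : ℕ} {p q : Fin d}
    {φ : EuclideanSpace ℝ (Fin d) → ℝ} {ε M : ℝ} {m A B : ℂ}
    (h : (m, A, B) ∈ closure (oscillationIntegrals p q φ ε M)) (a : ℝ) :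
    (m, (1 + Complex.I * a / 2) * A, B + Complex.I * a / 2 * A) ∈
      closure (oscillationIntegrals p q φ ε (M * √(1 + a ^ 2))) := by
  let T : ℂ × ℂ × ℂ → ℂ × ℂ × ℂ := fun v =>
    (v.1, (1 + Complex.I * a / 2) * v.2.1, v.2.2 + Complex.I * a / 2 * v.2.1)
  have hT : Continuous T := by fun_prop
  have hmaps : Set.MapsTo T (oscillationIntegrals p q φ ε M)
      (closure (oscillationIntegrals p q φ ε (M * √(1 + a ^ 2)))) := by
    rintro _ ⟨u, P, Z, R, hs, rfl⟩
    exact hs.integrals_mem_closure a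
  have := hmaps.closure hT h
  rwa [closure_closure] at this

theorem mem_closure_oscillationIntegrals_swap {d : ℕ} {p q : Fin d}
    {φ : EuclideanSpace ℝ (Fin d) → ℝ} {ε M : ℝ} {m A B : ℂ}
    (h : (m, A, B) ∈ closure (oscillationIntegrals p q φ ε M)) :
    (m, A, -B) ∈ closure (oscillationIntegrals q p φ ε M) := by
  have hT : Continuous fun v : ℂ × ℂ × ℂ => (v.1, v.2.1, -v.2.2) := by fun_prop
  refine (Set.MapsTo.closure ?_ hT) h
  rintro _ ⟨u, P, Z, R, hs, rfl⟩
  refine ⟨u, P, _, R, hs.swap, ?_⟩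
  simp [integral_neg]

theorem mem_closure_oscillationIntegrals_double_step {d : ℕ} {p q : Fin d}
    {φ : EuclideanSpace ℝ (Fin d) → ℝ} {ε M : ℝ} {m A B : ℂ}
    (h : (m, A, B) ∈ closure (oscillationIntegrals p q φ ε M)) (a : ℝ) :
    (m, (1 + a ^ 2 / 4) * A, B + (Complex.I * a - a ^ 2 / 4) * A) ∈
      closure (oscillationIntegrals p q φ ε (M * (1 + a ^ 2))) := by
  have h1 := mem_closure_oscillationIntegrals_swap (mem_closure_oscillationIntegrals_step
    (mem_closure_oscillationIntegrals_swap (mem_closure_oscillationIntegrals_step h a)) (-a))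
  rw [neg_sq, mul_assoc, Real.mul_self_sqrt (by positivity)] at h1
  convert h1 using 3
  · push_cast; linear_combination (A * a ^ 2 / 4) * Complex.I_sq
  · push_cast; linear_combination (-A * a ^ 2 / 4) * Complex.I_sq

theorem exists_mem_closure_oscillationIntegrals {d : ℕ} {p q : Fin d}
    {φ : EuclideanSpace ℝ (Fin d) → ℝ} {ε : ℝ} {m : ℝ} (hm : 0 ≤ m)
    (h : ((m : ℂ), (m : ℂ), (0 : ℂ)) ∈ closure (oscillationIntegrals p q φ ε 1)) {a : ℝ}
    (ha : 0 ≤ a) (n : ℕ) :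
    ∃ (A : ℝ) (B : ℂ), m ≤ A ∧ n * (a * m) ≤ B.im ∧
      ((m : ℂ), (A : ℂ), B) ∈ closure (oscillationIntegrals p q φ ε ((1 + a ^ 2) ^ n)) := by
  induction n with
  | zero => exact ⟨m, 0, le_rfl, by simp, by simpa using h⟩
  | succ n ih =>
    obtain ⟨A, B, hA, hB, hmem⟩ := ih
    refine ⟨(1 + a ^ 2 / 4) * A, B + (Complex.I * a - a ^ 2 / 4) * A, ?_, ?_, ?_⟩
    · nlinarith [mul_nonneg (sq_nonneg a) (hm.trans hA)]
    · have : (B + (Complex.I * a - a ^ 2 / 4) * A).im = B.im + a * A := by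
        have : B + (Complex.I * a - a ^ 2 / 4) * A
          = B + ((-(a ^ 2 / 4 * A) : ℝ) : ℂ) + ((a * A : ℝ) : ℂ) * Complex.I := by push_cast; ring
        rw [this]
        simp only [Complex.add_im, Complex.ofReal_im, Complex.im_ofReal_mul, Complex.I_im]
        ring
      rw [this]
      push_cast
      nlinarith [mul_le_mul_of_nonneg_left hA ha]
    · have := mem_closure_oscillationIntegrals_double_step hmem a
      rw [pow_succ]
      push_cast
      exact this

section Frobenius

variable {d : ℕ}

theorem frob_eq_norm (M : Matrix (Fin d) (Fin d) ℝ) :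
    frob M = ‖WithLp.toLp 2 fun k : Fin d × Fin d => M k.1 k.2‖ := by
  simp [frob, EuclideanSpace.norm_eq, Fintype.sum_prod_type]

theorem frob_nonneg (M : Matrix (Fin d) (Fin d) ℝ) : 0 ≤ frob M := Real.sqrt_nonneg _

theorem frob_neg (M : Matrix (Fin d) (Fin d) ℝ) : frob (-M) = frob M := by
  simp [frob]

theorem frob_le_frob_sub_add (M F : Matrix (Fin d) (Fin d) ℝ) :
    frob M ≤ frob (M - F) + frob F := by
  simp only [frob_eq_norm]
  refine le_trans (le_of_eq ?_) (norm_add_le _ _)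
  congr 1
  ext k
  simp

theorem abs_apply_le_frob (M : Matrix (Fin d) (Fin d) ℝ) (i j : Fin d) : |M i j| ≤ frob M := by
  rw [frob_eq_norm]
  exact PiLp.norm_apply_le (WithLp.toLp 2 fun k : Fin d × Fin d => M k.1 k.2) (i, j)

theorem frob_le_of_abs_apply_le {M : Matrix (Fin d) (Fin d) ℝ} {c : ℝ} (hc : 0 ≤ c)
    (h : ∀ i j, |M i j| ≤ c) : frob M ≤ d * c := by
  refine Real.sqrt_le_iff.2 ⟨by positivity, ?_⟩
  calc ∑ i, ∑ j, M i j ^ 2 ≤ ∑ _i : Fin d, ∑ _j : Fin d, c ^ 2 := by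
        refine Finset.sum_le_sum fun i _ => Finset.sum_le_sum fun j _ => ?_
        exact sq_le_sq.2 ((h i j).trans (le_abs_self c))
    _ = (d * c) ^ 2 := by simp; ring

theorem Continuous.frob {X : Type*} [TopologicalSpace X] {M : X → Matrix (Fin d) (Fin d) ℝ}
    (hM : Continuous M) : Continuous fun x => frob (M x) := by
  have : ∀ i j, Continuous fun x => M x i j := fun i j => hM.matrix_elem i j
  unfold _root_.frob
  fun_prop

end Frobenius

section Jacobian

variable {d : ℕ} {u : EuclideanSpace ℝ (Fin d) → EuclideanSpace ℝ (Fin d)}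

theorem ContDiff.continuous_jacob (hu : ContDiff ℝ 1 u) : Continuous (jacob u) := by
  have h := hu.continuous_fderiv one_ne_zero
  refine continuous_matrix fun i j => ?_
  unfold jacob
  fun_prop

theorem jacob_eq_zero_of_notMem_closedBall {r : ℝ} (hu : ∀ x, x ∉ Metric.closedBall 0 r → u x = 0)
    {x : EuclideanSpace ℝ (Fin d)} (hx : x ∉ Metric.closedBall 0 r) : jacob u x = 0 := by
  have h : u =ᶠ[𝓝 x] fun _ => 0 := by
    filter_upwards [Metric.isClosed_closedBall.isOpen_compl.mem_nhds hx] with y hy using hu y hy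
  ext i j
  simp [jacob, h.fderiv_eq]

theorem Continuous.integrableOn_unitBall {f : EuclideanSpace ℝ (Fin d) → ℝ} (hf : Continuous f) :
    IntegrableOn f (Metric.ball 0 1) :=
  (hf.continuousOn.integrableOn_compact (isCompact_closedBall 0 1)).mono_set
    Metric.ball_subset_closedBall

/-- A field supported in the ball of radius `1/2` has no better `L¹` approximation of its Jacobian
by a constant matrix than `0`, up to a constant. -/
theorem integral_frob_jacob_le_mul_integral_frob_sub (hu : ContDiff ℝ 1 u)
    (hu0 : ∀ x, x ∉ Metric.closedBall 0 (1 / 2) → u x = 0)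
    (hA : 0 < volume.real
      (Metric.ball (0 : EuclideanSpace ℝ (Fin d)) 1 \ Metric.closedBall 0 (1 / 2)))
    (F : Matrix (Fin d) (Fin d) ℝ) :
    ∫ x in Metric.ball (0 : EuclideanSpace ℝ (Fin d)) 1, frob (jacob u x) ≤
      (1 + volume.real (Metric.ball (0 : EuclideanSpace ℝ (Fin d)) 1) / volume.real
        (Metric.ball (0 : EuclideanSpace ℝ (Fin d)) 1 \ Metric.closedBall 0 (1 / 2))) *
      ∫ x in Metric.ball (0 : EuclideanSpace ℝ (Fin d)) 1, frob (jacob u x - F) := by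
  set A := Metric.ball (0 : EuclideanSpace ℝ (Fin d)) 1 \ Metric.closedBall 0 (1 / 2)
  have hJF : IntegrableOn (fun x => frob (jacob u x - F)) (Metric.ball 0 1) :=
    (hu.continuous_jacob.sub continuous_const).frob.integrableOn_unitBall
  have hF : IntegrableOn (fun _ : EuclideanSpace ℝ (Fin d) => frob F) (Metric.ball 0 1) :=
    continuous_const.integrableOn_unitBall
  have h1 : ∫ x in Metric.ball (0 : EuclideanSpace ℝ (Fin d)) 1, frob (jacob u x) ≤
      (∫ x in Metric.ball (0 : EuclideanSpace ℝ (Fin d)) 1, frob (jacob u x - F))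
        + volume.real (Metric.ball (0 : EuclideanSpace ℝ (Fin d)) 1) * frob F := by
    rw [← smul_eq_mul, ← setIntegral_const, ← integral_add hJF hF]
    exact integral_mono hu.continuous_jacob.frob.integrableOn_unitBall (hJF.add hF)
      fun x => frob_le_frob_sub_add _ _
  have h2 : volume.real A * frob F ≤
      ∫ x in Metric.ball (0 : EuclideanSpace ℝ (Fin d)) 1, frob (jacob u x - F) := by
    have hAm : MeasurableSet A := measurableSet_ball.diff Metric.isClosed_closedBall.measurableSet
    calc volume.real A * frob F = ∫ x in A, frob (jacob u x - F) := by
          rw [← smul_eq_mul, ← setIntegral_const]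
          refine setIntegral_congr_fun hAm fun x hx => ?_
          simp [jacob_eq_zero_of_notMem_closedBall hu0 hx.2, frob_neg]
      _ ≤ _ := setIntegral_mono_set hJF (ae_of_all _ fun x => frob_nonneg _)
          Set.sdiff_subset.eventuallyLE
  have h3 : frob F ≤ (∫ x in Metric.ball (0 : EuclideanSpace ℝ (Fin d)) 1,
      frob (jacob u x - F)) / volume.real A := by
    rw [le_div_iff₀ hA, mul_comm]; exact h2
  calc _ ≤ _ := h1
    _ ≤ _ := by
      grw [h3]
      exact le_of_eq (by ring)

end Jacobian

theorem isOscillation_initial {d : ℕ} (p q : Fin d) {φ : EuclideanSpace ℝ (Fin d) → ℝ} {ε : ℝ}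
    (hε : 0 < ε) (hφ : ContDiff ℝ 1 φ) (hφ0 : ∀ x, x ∉ Metric.closedBall 0 (1 / 2) → φ x = 0)
    (hφn : ∀ x, 0 ≤ φ x) :
    IsOscillation p q φ ε 1 (fun _ => 0) φ (fun _ => 0) (fun _ => 1) where
  contDiff_field := contDiff_const
  contDiff_sum := hφ
  continuous_diff := continuous_const
  continuous_test := continuous_const
  field_eq_zero _ _ := rfl
  sum_eq_zero := hφ0
  diff_eq_zero _ _ := rfl
  sum_nonneg := hφn
  norm_test_le _ := by simp
  jacob_close := ⟨0, hε, fun x i j => by simp [jacob]⟩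

namespace IsOscillation

variable {d : ℕ} {p q : Fin d} {φ : EuclideanSpace ℝ (Fin d) → ℝ} {ε M : ℝ}
  {u : EuclideanSpace ℝ (Fin d) → EuclideanSpace ℝ (Fin d)}
  {P Z : EuclideanSpace ℝ (Fin d) → ℝ} {R : EuclideanSpace ℝ (Fin d) → ℂ}

theorem frob_symm_le (h : IsOscillation p q φ ε M u P Z R) (hφ : ∀ x, 0 ≤ φ x)
    (x : EuclideanSpace ℝ (Fin d)) :
    frob ((1 / 2 : ℝ) • (jacob u x + (jacob u x).transpose)) ≤ d * (ε + P x + φ x) := by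
  obtain ⟨δ, hδ, hj⟩ := h.jacob_close
  have hP := h.sum_nonneg x
  have hφx := hφ x
  have hent : ∀ i j, |((1 / 2 : ℝ) • (jacob u x + (jacob u x).transpose)) i j|
      ≤ ε + P x + φ x := by
    intro i j
    have h1 := hj x i j
    have h2 := hj x j i
    simp only [Matrix.smul_apply, Matrix.add_apply, Matrix.transpose_apply, smul_eq_mul]
    simp only [and_comm (a := j = p), and_comm (a := j = q)] at h2
    rw [abs_le] at h1 h2 ⊢
    split_ifs at h1 h2 <;> constructor <;> linarith
  exact frob_le_of_abs_apply_le ((abs_nonneg _).trans (hent p q)) hent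

theorem abs_diff_le (h : IsOscillation p q φ ε M u P Z R) (hpq : p ≠ q)
    (x : EuclideanSpace ℝ (Fin d)) : |Z x| ≤ 2 * (frob (jacob u x) + ε) := by
  obtain ⟨δ, hδ, hj⟩ := h.jacob_close
  have h1 := hj x p q
  have h2 := hj x q p
  have h3 := abs_apply_le_frob (jacob u x) p q
  have h4 := abs_apply_le_frob (jacob u x) q p
  simp only [hpq, hpq.symm, and_self, if_true, if_false] at h1 h2
  rw [abs_le] at *
  constructor <;> linarith

theorem norm_integral_diff_mul_test_le (h : IsOscillation p q φ ε M u P Z R) (hpq : p ≠ q) :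
    ‖∫ x, (Z x : ℂ) * R x‖ ≤ 2 * M *
      ((∫ x in Metric.ball (0 : EuclideanSpace ℝ (Fin d)) 1, frob (jacob u x))
        + volume.real (Metric.ball (0 : EuclideanSpace ℝ (Fin d)) 1) * ε) := by
  have hb : ∀ x, ‖(Z x : ℂ) * R x‖ ≤ 2 * M * (frob (jacob u x) + ε) := by
    intro x
    rw [norm_mul, Complex.norm_real, Real.norm_eq_abs]
    calc _ ≤ 2 * (frob (jacob u x) + ε) * M :=
          mul_le_mul (h.abs_diff_le hpq x) (h.norm_test_le x) (norm_nonneg _)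
            ((abs_nonneg _).trans (h.abs_diff_le hpq x))
      _ = _ := by ring
  have hJ := h.contDiff_field.continuous_jacob.frob
  rw [← setIntegral_eq_integral_of_forall_compl_eq_zero (s := Metric.ball 0 1) fun x hx => by
    rw [h.diff_eq_zero x fun hx' => hx (Metric.closedBall_subset_ball (by norm_num) hx')]; simp]
  rw [← smul_eq_mul (volume.real _), ← setIntegral_const,
    ← integral_add hJ.integrableOn_unitBall continuous_const.integrableOn_unitBall,
    ← integral_const_mul]
  exact norm_integral_le_of_norm_le
    (((hJ.add continuous_const).integrableOn_unitBall).const_mul _) (ae_of_all _ hb)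

theorem integral_frob_symm_le (h : IsOscillation p q φ ε M u P Z R) (hφ : ∀ x, 0 ≤ φ x)
    (hφc : Continuous φ) (hφi : Integrable φ) :
    ∫ x in Metric.ball (0 : EuclideanSpace ℝ (Fin d)) 1,
        frob ((1 / 2 : ℝ) • (jacob u x + (jacob u x).transpose))
      ≤ d * (volume.real (Metric.ball (0 : EuclideanSpace ℝ (Fin d)) 1) * ε
        + (∫ x, P x) + ∫ x, φ x) := by
  have hc : Continuous fun _ : EuclideanSpace ℝ (Fin d) => ε := continuous_const
  have hcP := h.contDiff_sum.continuous
  have hcJ := h.contDiff_field.continuous_jacob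
  have hPi := hcP.integrable_of_hasCompactSupport (μ := volume) h.hasCompactSupport_sum
  calc _ ≤ ∫ x in Metric.ball (0 : EuclideanSpace ℝ (Fin d)) 1, d * (ε + P x + φ x) :=
        integral_mono
          ((hcJ.add hcJ.matrix_transpose).const_smul (1 / 2 : ℝ)).frob.integrableOn_unitBall
          (Continuous.integrableOn_unitBall (by fun_prop)) fun x => h.frob_symm_le hφ x
    _ = d * (volume.real (Metric.ball (0 : EuclideanSpace ℝ (Fin d)) 1) * ε
        + (∫ x in Metric.ball 0 1, P x) + ∫ x in Metric.ball 0 1, φ x) := by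
      rw [integral_const_mul, integral_add (f := fun x => ε + P x)
        (hc.add hcP).integrableOn_unitBall hφc.integrableOn_unitBall,
        integral_add hc.integrableOn_unitBall hcP.integrableOn_unitBall, setIntegral_const,
        smul_eq_mul]
    _ ≤ _ := by
      have h1 := setIntegral_le_integral (s := Metric.ball 0 1) hPi (ae_of_all _ h.sum_nonneg)
      have h2 := setIntegral_le_integral (s := Metric.ball 0 1) hφi (ae_of_all _ hφ)
      grw [h1, h2]

end IsOscillation

/-- The oscillation can be made large in `L¹` while the sum of the entries stays bounded. -/
theorem exists_isOscillation_large {d : ℕ} (p q : Fin d) {φ : EuclideanSpace ℝ (Fin d) → ℝ}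
    (hφ : ContDiff ℝ 1 φ) (hφ0 : ∀ x, x ∉ Metric.closedBall 0 (1 / 2) → φ x = 0)
    (hφn : ∀ x, 0 ≤ φ x) (hm : 0 < ∫ x, φ x) {ε : ℝ} (hε : 0 < ε) (k : ℕ) (hk : k ≠ 0) :
    ∃ u P Z R, IsOscillation p q φ ε 3 u P Z R ∧ ∫ x, P x ≤ 2 * ∫ x, φ x ∧
      ((k : ℝ) - 1) * ∫ x, φ x ≤ ‖∫ x, (Z x : ℂ) * R x‖ := by
  set m := ∫ x, φ x with hmdef
  have h0 : ((m : ℂ), (m : ℂ), (0 : ℂ)) ∈ closure (oscillationIntegrals p q φ ε 1) :=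
    subset_closure ⟨_, _, _, _, isOscillation_initial p q hε hφ hφ0 hφn, by
      simp [hmdef, integral_complex_ofReal]⟩
  obtain ⟨A, B, -, hB, hmem⟩ := exists_mem_closure_oscillationIntegrals hm.le h0
    (a := 1 / k) (by positivity) (k ^ 2)
  have hk0 : (k : ℝ) ≠ 0 := by exact_mod_cast hk
  have hB' : k * m ≤ B.im := by
    refine le_trans (le_of_eq ?_) hB
    push_cast
    field_simp
  have hM : (1 + (1 / k : ℝ) ^ 2) ^ (k ^ 2) ≤ 3 := by
    calc (1 + (1 / k : ℝ) ^ 2) ^ (k ^ 2) ≤ Real.exp ((1 / k : ℝ) ^ 2) ^ (k ^ 2) := by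
          gcongr
          rw [add_comm]
          exact Real.add_one_le_exp _
      _ = Real.exp 1 := by
          rw [← Real.exp_nat_mul]
          congr 1
          push_cast
          field_simp
      _ ≤ 3 := Real.exp_one_lt_three.le
  obtain ⟨_, ⟨u, P, Z, R, h, rfl⟩, hd⟩ := Metric.mem_closure_iff.1 hmem m hm
  rw [Prod.dist_eq, Prod.dist_eq, max_lt_iff, max_lt_iff] at hd
  obtain ⟨hd1, -, hd3⟩ := hd
  refine ⟨u, P, Z, R, { h with norm_test_le := fun x => (h.norm_test_le x).trans hM }, ?_, ?_⟩
  · dsimp only at hd1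
    rw [integral_complex_ofReal, Complex.dist_eq, ← Complex.ofReal_sub, Complex.norm_real,
      Real.norm_eq_abs, abs_lt] at hd1
    linarith [hd1.1]
  · dsimp only at hd3
    rw [dist_eq_norm] at hd3
    have h1 := (Complex.abs_im_le_norm _).trans_lt hd3
    rw [Complex.sub_im, abs_lt] at h1
    have h2 := (abs_le.1 (Complex.abs_im_le_norm (∫ x, (Z x : ℂ) * R x))).2
    linarith [h1.2]

/-- Ornstein's non-inequality / failure of the L¹ Korn inequality (`d ≥ 2`): for every
`N > 0` there is a Lipschitz map `u : ℝ^d → ℝ^d` vanishing outside the open unit ball with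
`∫_{B₁} |Du| > 0` and `inf_F ∫_{B₁} |Du − F| ≥ N ∫_{B₁} |(Du + Duᵀ)/2|`. -/
theorem ornstein_non_inequality {d : ℕ} (hd : 2 ≤ d) (N : ℝ) (hN : 0 < N) :
    ∃ u : EuclideanSpace ℝ (Fin d) → EuclideanSpace ℝ (Fin d),
      (∃ K, LipschitzWith K u) ∧
      (∀ x, 1 ≤ ‖x‖ → u x = 0) ∧
      (0 < ∫ x in Metric.ball (0 : EuclideanSpace ℝ (Fin d)) 1, frob (jacob u x)) ∧
      ∀ F : Matrix (Fin d) (Fin d) ℝ,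
        N * ∫ x in Metric.ball (0 : EuclideanSpace ℝ (Fin d)) 1,
              frob ((1 / 2 : ℝ) • (jacob u x + (jacob u x).transpose))
          ≤ ∫ x in Metric.ball (0 : EuclideanSpace ℝ (Fin d)) 1, frob (jacob u x - F) := by
  let p : Fin d := ⟨0, by omega⟩
  let q : Fin d := ⟨1, by omega⟩
  have hpq : p ≠ q := by simp [p, q]
  let φ : ContDiffBump (0 : EuclideanSpace ℝ (Fin d)) := ⟨1 / 4, 1 / 2, by norm_num, by norm_num⟩
  have hφ0 : ∀ x, x ∉ Metric.closedBall 0 (1 / 2) → φ x = 0 := by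
    intro x hx
    rw [Metric.mem_closedBall, not_le] at hx
    exact φ.zero_of_le_dist hx.le
  have hm : 0 < ∫ x, φ x := φ.integral_pos
  set m := ∫ x, φ x
  set V := volume.real (Metric.ball (0 : EuclideanSpace ℝ (Fin d)) 1)
  have hV : 0 < V := ENNReal.toReal_pos (Metric.measure_ball_pos _ _ one_pos).ne'
    measure_ball_lt_top.ne
  have hA : 0 < volume.real
      (Metric.ball (0 : EuclideanSpace ℝ (Fin d)) 1 \ Metric.closedBall 0 (1 / 2)) := by
    refine ENNReal.toReal_pos (IsOpen.measure_pos _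
      (Metric.isOpen_ball.sdiff Metric.isClosed_closedBall)
      ⟨EuclideanSpace.single p (3 / 4 : ℝ), ?_⟩).ne'
      (measure_ne_top_of_subset Set.sdiff_subset measure_ball_lt_top.ne)
    simp
    norm_num [abs_of_pos]
  set c := 1 + V / volume.real
    (Metric.ball (0 : EuclideanSpace ℝ (Fin d)) 1 \ Metric.closedBall 0 (1 / 2))
  have hc0 : 0 < c := by positivity
  obtain ⟨k, hk⟩ := exists_nat_gt (7 + 6 * (c * (N * (d * 4))))
  have hcN : 0 ≤ c * (N * (d * 4)) := by positivity
  have hk0 : k ≠ 0 := by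
    rintro rfl
    push_cast at hk
    linarith
  obtain ⟨u, P, Z, R, h, hP, hZ⟩ := exists_isOscillation_large p q φ.contDiff hφ0
    (fun _ => φ.nonneg) hm (div_pos hm hV) k hk0
  have hZ' := hZ.trans (h.norm_integral_diff_mul_test_le hpq)
  have hE := h.integral_frob_symm_le (fun _ => φ.nonneg) φ.continuous φ.integrable
  rw [mul_div_cancel₀ _ hV.ne'] at hZ' hE
  have hJ : c * (N * (d * 4)) * m <
      ∫ x in Metric.ball (0 : EuclideanSpace ℝ (Fin d)) 1, frob (jacob u x) := by
    nlinarith [mul_lt_mul_of_pos_right hk hm]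
  refine ⟨u, ?_, fun x hx => ?_, lt_of_le_of_lt (by positivity) hJ, fun F => ?_⟩
  · exact ContDiff.lipschitzWith_of_hasCompactSupport
      (HasCompactSupport.intro (isCompact_closedBall 0 (1 / 2)) h.field_eq_zero)
      h.contDiff_field one_ne_zero
  · refine h.field_eq_zero x fun hx' => ?_
    rw [mem_closedBall_zero_iff] at hx'
    linarith
  · refine le_of_mul_le_mul_left (le_trans ?_ (integral_frob_jacob_le_mul_integral_frob_sub
      h.contDiff_field h.field_eq_zero hA F)) hc0
    refine le_trans ?_ hJ.le
    calc _ ≤ c * (N * (d * (m + 2 * m + m))) := by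
          gcongr
          refine hE.trans ?_
          gcongr
      _ = _ := by ring
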